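/- If G is a member of F_{3,j} (for some 0 ≤ j ≤ 3) with girth at least 5, then j = 3 and G is isomorphic to one of the two connected cubic graphs on 12 vertices with girth at least 5. Conversely, both connected cubic graphs on 12 vertices with girth at least 5 belong to F_{3,3}. -/

import Mathlib

open SimpleGraph

namespace InducedForest

/-- A graph is subcubic if every vertex has at most 3 neighbours. -/
def Subcubic {V : Type} (G : SimpleGraph V) : Prop := ∀ v : V, (G.neighborSet v).ncard ≤ 3

/-- A graph is cubic if every vertex has exactly 3 neighbours. -/
def Cubic {V : Type} (G : SimpleGraph V) : Prop := ∀ v : V, (G.neighborSet v).ncard = 3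

/-- `S` is a feedback vertex set of `G` iff `G - S` is a forest. -/
def IsFVS {V : Type} (G : SimpleGraph V) (S : Set V) : Prop := (G.induce Sᶜ).IsAcyclic

/-- `φ(G)`: the minimum size of a feedback vertex set of `G`. -/
noncomputable def fvs {V : Type} (G : SimpleGraph V) : ℕ :=
  sInf {n : ℕ | ∃ S : Set V, IsFVS G S ∧ S.ncard = n}

/-- `a(G)`: the maximum number of vertices of an induced forest in `G`. -/
noncomputable def indForestNum {V : Type} (G : SimpleGraph V) : ℕ :=
  sSup {n : ℕ | ∃ S : Set V, (G.induce S).IsAcyclic ∧ S.ncard = n}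

/-- `v` is a cut-vertex of `G`: deleting it increases the number of connected components. -/
def IsCutVertex {V : Type} (G : SimpleGraph V) (v : V) : Prop :=
  Nat.card G.ConnectedComponent < Nat.card (G.induce {u | u ≠ v}).ConnectedComponent

/-- `B` is a block of `G`: a maximal set of vertices inducing a connected subgraph
without cut-vertices. -/
def IsBlock {V : Type} (G : SimpleGraph V) (B : Set V) : Prop :=
  ((G.induce B).Connected ∧ ∀ v, ¬ IsCutVertex (G.induce B) v) ∧
  ∀ B' : Set V, B ⊆ B' →
    ((G.induce B').Connected ∧ ∀ v, ¬ IsCutVertex (G.induce B') v) → B' = B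

/-- 2-connectedness: at least 3 vertices and removing fewer than 2 vertices
leaves a connected graph. -/
def TwoConnected {V : Type} (G : SimpleGraph V) : Prop :=
  3 ≤ Nat.card V ∧ ∀ s : Set V, s.ncard < 2 → (G.induce sᶜ).Connected

/-- 3-connectedness: at least 4 vertices and removing fewer than 3 vertices
leaves a connected graph. -/
def ThreeConnected {V : Type} (G : SimpleGraph V) : Prop :=
  4 ≤ Nat.card V ∧ ∀ s : Set V, s.ncard < 3 → (G.induce sᶜ).Connected

/-- The graph obtained from `H` by subdividing the edge `xy` once;
the subdivision vertex is `none`. -/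
def subdivide {V : Type} (H : SimpleGraph V) (x y : V) : SimpleGraph (Option V) :=
  SimpleGraph.fromRel (fun p q =>
    match p, q with
    | some u, some v => H.Adj u v ∧ s(u, v) ≠ s(x, y)
    | some u, none => u = x ∨ u = y
    | _, _ => False)

/-- `G` is obtained from `H` by subdividing one edge once. -/
def IsSubdivisionOfOneEdge {V W : Type} (H : SimpleGraph V) (G : SimpleGraph W) : Prop :=
  ∃ x y : V, H.Adj x y ∧ Nonempty (G ≃g subdivide H x y)

/-- The graph obtained from `K` by adding one new vertex (`none`)
joined to all vertices of `S`. -/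
def addApex {V : Type} (K : SimpleGraph V) (S : Set V) : SimpleGraph (Option V) :=
  SimpleGraph.fromRel (fun p q =>
    match p, q with
    | some u, some v => K.Adj u v
    | some u, none => u ∈ S
    | _, _ => False)

/-- `G` is (isomorphic to) `H ∘ (e1, e2, a)`: subdivide `e1` and `e2` once each
(with `e1` subdivided twice if `e1 = e2`) and add a new vertex adjacent to `a` and to the
two subdivision vertices. -/
def IsCircOp {V W : Type} (H : SimpleGraph V) (e1 e2 : Sym2 V) (a : V)
    (G : SimpleGraph W) : Prop :=
  (e1 ≠ e2 ∧ ∃ x1 y1 x2 y2 : V, e1 = s(x1, y1) ∧ e2 = s(x2, y2) ∧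
    Nonempty (G ≃g addApex (subdivide (subdivide H x1 y1) (some x2) (some y2))
      {some (some a), some none, none})) ∨
  (e1 = e2 ∧ ∃ x y : V, e1 = s(x, y) ∧
    Nonempty (G ≃g addApex (subdivide (subdivide H x y) none (some y))
      {some (some a), some none, none}))

/-- The cycle of length `n` (for `n ≥ 3`). -/
def cyc (n : ℕ) : SimpleGraph (ZMod n) :=
  SimpleGraph.fromRel (fun u v => v = u + 1)

/-- The families `F_{i,j}` of graphs (closed under isomorphism):
`F_{i,0} = {C_i}` for `i ≥ 3`; `F_{1,1} = {K_4}`; `F_{j,j}` for `j ≥ 2` is obtained from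
`F_{j-1,j-1}` by subdividing one edge once and then applying the `∘` operation at the
subdivision vertex; and `F_{i,j}` for `i > j ≥ 1` is obtained from `F_{j,j}` by `i - j`
successive single-edge subdivisions. -/
inductive MemF : ℕ → ℕ → ∀ {V : Type}, SimpleGraph V → Prop
  | cycle {i : ℕ} (hi : 3 ≤ i) {V : Type} {G : SimpleGraph V}
      (h : Nonempty (G ≃g cyc i)) : MemF i 0 G
  | k4 {V : Type} {G : SimpleGraph V}
      (h : Nonempty (G ≃g (⊤ : SimpleGraph (Fin 4)))) : MemF 1 1 G
  | circ {j : ℕ} (hj : 2 ≤ j) {V : Type} {H : SimpleGraph V}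
      (hH : MemF (j - 1) (j - 1) H) {x y : V} (hxy : H.Adj x y)
      {e1 e2 : Sym2 (Option V)} (he1 : e1 ∈ (subdivide H x y).edgeSet)
      (he2 : e2 ∈ (subdivide H x y).edgeSet)
      {W : Type} {G : SimpleGraph W}
      (hG : IsCircOp (subdivide H x y) e1 e2 none G) : MemF j j G
  | subd {i j : ℕ} (hj : 1 ≤ j) {V : Type} {H : SimpleGraph V}
      (hH : MemF i j H) {x y : V} (hxy : H.Adj x y) {W : Type} {G : SimpleGraph W}
      (hG : Nonempty (G ≃g subdivide H x y)) : MemF (i + 1) j G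

/-- `K_4^+`: the graph obtained from `K_4` by subdividing one edge once. -/
def K4plus : SimpleGraph (Option (Fin 4)) :=
  subdivide (⊤ : SimpleGraph (Fin 4)) 0 1

/-- `L`: the graph obtained from `K_4` by subdividing once each edge
of a perfect matching. -/
def Lgraph : SimpleGraph (Option (Option (Fin 4))) :=
  subdivide (subdivide (⊤ : SimpleGraph (Fin 4)) 0 1) (some 2) (some 3)

/-- The Petersen graph. -/
def petersen : SimpleGraph (ZMod 5 × Fin 2) :=
  SimpleGraph.fromRel (fun u v =>
    (u.2 = 0 ∧ v.2 = 0 ∧ v.1 = u.1 + 1) ∨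
    (u.2 = 1 ∧ v.2 = 1 ∧ v.1 = u.1 + 2) ∨
    (u.2 = 0 ∧ v.2 = 1 ∧ u.1 = v.1))

/-- `R`: the Petersen graph minus one edge. -/
def Rgraph : SimpleGraph (ZMod 5 × Fin 2) :=
  petersen.deleteEdges {s(((0 : ZMod 5), (0 : Fin 2)), ((1 : ZMod 5), (0 : Fin 2)))}

/-- `Q_3`: the 3-dimensional cube graph. -/
def Q3 : SimpleGraph (Fin 2 × Fin 2 × Fin 2) :=
  SimpleGraph.fromRel (fun u v =>
    (u.1 ≠ v.1 ∧ u.2 = v.2) ∨ (u.1 = v.1 ∧ u.2.1 ≠ v.2.1 ∧ u.2.2 = v.2.2) ∨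
    (u.1 = v.1 ∧ u.2.1 = v.2.1 ∧ u.2.2 ≠ v.2.2))

/-- `V_8`: the Wagner graph. -/
def V8 : SimpleGraph (ZMod 8) :=
  SimpleGraph.fromRel (fun u v => v = u + 1 ∨ v = u + 4)

/-- The dodecahedron, presented as the generalized Petersen graph `GP(10,2)`. -/
def dodecahedron : SimpleGraph (ZMod 10 × Fin 2) :=
  SimpleGraph.fromRel (fun u v =>
    (u.2 = 0 ∧ v.2 = 0 ∧ v.1 = u.1 + 1) ∨
    (u.2 = 1 ∧ v.2 = 1 ∧ v.1 = u.1 + 2) ∨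
    (u.2 = 0 ∧ v.2 = 1 ∧ u.1 = v.1))

/-- The families `F^g_{i,j,k}`: 2-connected subcubic graphs obtained from the disjoint
union of `k` copies of `L` (when `g = 4`) or of `R` (when `g = 5`) and one member of
`F_{i,j}` by adding `k+1` edges; when `k ≥ 1`, each added edge joins two different
constituent copies. -/
def MemFG (g i j k : ℕ) {W : Type} (G : SimpleGraph W) : Prop :=
  TwoConnected G ∧ Subcubic G ∧
  ∃ (P : W → Fin (k + 1)) (H : SimpleGraph W),
    H ≤ G ∧ (∀ u v, H.Adj u v → P u = P v) ∧
    MemF i j (H.induce (P ⁻¹' {0})) ∧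
    ((g = 4 ∧ ∀ l : Fin (k + 1), l ≠ 0 → Nonempty ((H.induce (P ⁻¹' {l})) ≃g Lgraph)) ∨
     (g = 5 ∧ ∀ l : Fin (k + 1), l ≠ 0 → Nonempty ((H.induce (P ⁻¹' {l})) ≃g Rgraph))) ∧
    (G.edgeSet \ H.edgeSet).ncard = k + 1 ∧
    (1 ≤ k → ∀ u v, G.Adj u v → ¬ H.Adj u v → P u ≠ P v)

/-- `t_4 = 2/9`, `t_5 = 1/5`. -/
noncomputable def tg (g : ℕ) : ℝ := if g = 4 then 2 / 9 else 1 / 5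

/-- The error function `ε_g` on graphs. -/
noncomputable def eps (g : ℕ) {V : Type} (G : SimpleGraph V) : ℝ := by
  classical
  exact
    if h1 : ∃ p : ℕ × ℕ, 1 ≤ p.1 ∧ p.2 ≤ p.1 ∧ MemF p.1 p.2 G then
      max (1 - (h1.choose.2 : ℝ) * (5 * tg g - 1) - (h1.choose.1 : ℝ) * tg g) 0
    else if h2 : ∃ q : ℕ × ℕ × ℕ, 1 ≤ q.1 ∧ q.2.1 ≤ q.1 ∧ MemFG g q.1 q.2.1 q.2.2 G then
      max (1 - tg g - (h2.choose.2.1 : ℝ) * (5 * tg g - 1) - (h2.choose.1 : ℝ) * tg g) 0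
    else if Nonempty (G ≃g (⊤ : SimpleGraph (Fin 2))) then -tg g
    else 0

/-- The error function `r_g(G)`: the sum of `ε_g(B)` over all blocks `B` of `G`. -/
noncomputable def rg (g : ℕ) {V : Type} (G : SimpleGraph V) : ℝ :=
  ∑ᶠ B ∈ {B : Set V | IsBlock G B}, eps g (G.induce B)

/-- `G` has two vertex-disjoint cycles, each of length less than `g`. -/
def TwoDisjointCyclesLt {V : Type} (G : SimpleGraph V) (g : ℕ) : Prop :=
  ∃ (u v : V) (c1 : G.Walk u u) (c2 : G.Walk v v), c1.IsCycle ∧ c2.IsCycle ∧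
    c1.length < g ∧ c2.length < g ∧ ∀ x, x ∈ c1.support → x ∉ c2.support

/-- `G` contains a (not necessarily induced) subgraph isomorphic to `K`. -/
def ContainsSubgraphCopy {U V : Type} (K : SimpleGraph U) (G : SimpleGraph V) : Prop :=
  ∃ f : U → V, Function.Injective f ∧ ∀ u v, K.Adj u v → G.Adj (f u) (f v)

/-- `G` is obtained from `H` by adding edges, each of which is a cut-edge of `G`. -/
def AddCutEdges {V : Type} (H G : SimpleGraph V) : Prop :=
  H ≤ G ∧ ∀ e ∈ G.edgeSet \ H.edgeSet, G.IsBridge e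

/-- The edges of `H` all lie inside the parts of the partition given by `P`. -/
def PartitionedBy {V ι : Type} (H : SimpleGraph V) (P : V → ι) : Prop :=
  ∀ u v, H.Adj u v → P u = P v

/-- `G` is `g`-minimal: a minimum counterexample to the main theorem. -/
def GMinimal (g : ℕ) {V : Type} [Fintype V] (G : SimpleGraph V) : Prop :=
  Subcubic G ∧ ¬ TwoDisjointCyclesLt G g ∧
  tg g * G.edgeSet.ncard + rg g G < (fvs G : ℝ) ∧
  ∀ (W : Type) [Fintype W] (H : SimpleGraph W), Nat.card W < Nat.card V →
    Subcubic H → ¬ TwoDisjointCyclesLt H g →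
    (fvs H : ℝ) ≤ tg g * H.edgeSet.ncard + rg g H

/-! ### Adjacency in the constructions -/

@[simp] theorem sub_ss {V : Type} (H : SimpleGraph V) (x y u v : V) :
    (subdivide H x y).Adj (some u) (some v) ↔ H.Adj u v ∧ s(u, v) ≠ s(x, y) := by
  simp only [subdivide, SimpleGraph.fromRel_adj]
  constructor
  · rintro ⟨h, h1 | h1⟩
    · exact h1
    · exact ⟨h1.1.symm, by rw [Sym2.eq_swap]; exact h1.2⟩
  · intro h
    refine ⟨fun e => h.1.ne (Option.some.inj e), Or.inl h⟩

@[simp] theorem sub_sn {V : Type} (H : SimpleGraph V) (x y u : V) :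
    (subdivide H x y).Adj (some u) none ↔ u = x ∨ u = y := by
  simp [subdivide, SimpleGraph.fromRel_adj]

@[simp] theorem sub_ns {V : Type} (H : SimpleGraph V) (x y u : V) :
    (subdivide H x y).Adj none (some u) ↔ u = x ∨ u = y := by
  simp [subdivide, SimpleGraph.fromRel_adj]

@[simp] theorem apex_ss {V : Type} (H : SimpleGraph V) (S : Set V) (u v : V) :
    (addApex H S).Adj (some u) (some v) ↔ H.Adj u v := by
  simp only [addApex, SimpleGraph.fromRel_adj]
  constructor
  · rintro ⟨h, h1 | h1⟩
    · exact h1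
    · exact h1.symm
  · intro h
    refine ⟨fun e => h.ne (Option.some.inj e), Or.inl h⟩

@[simp] theorem apex_sn {V : Type} (H : SimpleGraph V) (S : Set V) (u : V) :
    (addApex H S).Adj (some u) none ↔ u ∈ S := by
  simp [addApex, SimpleGraph.fromRel_adj]

@[simp] theorem apex_ns {V : Type} (H : SimpleGraph V) (S : Set V) (u : V) :
    (addApex H S).Adj none (some u) ↔ u ∈ S := by
  simp [addApex, SimpleGraph.fromRel_adj]

/-! ### Degrees -/

theorem deg_iso {V W : Type} {G : SimpleGraph V} {H : SimpleGraph W} (f : G ≃g H) (v : V) :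
    (H.neighborSet (f v)).ncard = (G.neighborSet v).ncard := by
  have := Nat.card_congr (f.mapNeighborSet v)
  simpa only [Nat.card_coe_set_eq] using this.symm

theorem deg_sub_some {V : Type} (H : SimpleGraph V) {x y : V} (h : H.Adj x y) (u : V) :
    ((subdivide H x y).neighborSet (some u)).ncard = (H.neighborSet u).ncard := by
  classical
  have : (subdivide H x y).neighborSet (some u) =
      (fun v => if s(u, v) = s(x, y) then none else some v) '' H.neighborSet u := by
    ext p
    cases p with
    | none =>
      simp only [mem_neighborSet, sub_sn, Set.mem_image]
      constructor
      · rintro (rfl | rfl)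
        · exact ⟨y, h, by simp⟩
        · exact ⟨x, h.symm, by simp [Sym2.eq_swap]⟩
      · rintro ⟨v, -, hv⟩
        by_cases e : s(u, v) = s(x, y)
        · rw [Sym2.eq_iff] at e
          tauto
        · simp [e] at hv
    | some v =>
      simp only [mem_neighborSet, sub_ss, Set.mem_image]
      constructor
      · rintro ⟨h1, h2⟩
        exact ⟨v, h1, by simp only [if_neg h2]⟩
      · rintro ⟨w, h1, h2⟩
        by_cases e : s(u, w) = s(x, y)
        · simp [e] at h2
        · simp only [if_neg e, Option.some.injEq] at h2
          subst h2
          exact ⟨h1, e⟩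
  rw [this, Set.ncard_image_of_injOn]
  intro a _ b _ hab
  simp only at hab
  split_ifs at hab with h1 h2
  · have := h1.trans h2.symm
    rw [Sym2.eq_iff] at this
    rcases this with h | h
    · exact h.2
    · exact h.2.trans h.1
  · exact Option.some.inj hab

theorem deg_sub_none {V : Type} (H : SimpleGraph V) {x y : V} (h : H.Adj x y) :
    ((subdivide H x y).neighborSet none).ncard = 2 := by
  have : (subdivide H x y).neighborSet none = {some x, some y} := by
    ext p
    cases p <;> simp
  rw [this, Set.ncard_pair]
  intro e
  exact h.ne (Option.some.inj e)

theorem deg_apex_none {V : Type} (H : SimpleGraph V) (S : Set V) :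
    ((addApex H S).neighborSet none).ncard = S.ncard := by
  have : (addApex H S).neighborSet none = some '' S := by
    ext p
    cases p <;> simp
  rw [this, Set.ncard_image_of_injective _ (Option.some_injective _)]

theorem deg_apex_some {V : Type} (H : SimpleGraph V) {S : Set V} {u : V} (hu : u ∉ S) :
    ((addApex H S).neighborSet (some u)).ncard = (H.neighborSet u).ncard := by
  have : (addApex H S).neighborSet (some u) = some '' H.neighborSet u := by
    ext p
    cases p <;> simp [hu]
  rw [this, Set.ncard_image_of_injective _ (Option.some_injective _)]

theorem deg_apex_mem {V : Type} [Finite V] (H : SimpleGraph V) {S : Set V} {u : V} (hu : u ∈ S) :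
    ((addApex H S).neighborSet (some u)).ncard = (H.neighborSet u).ncard + 1 := by
  have : (addApex H S).neighborSet (some u) = insert none (some '' H.neighborSet u) := by
    ext p
    cases p <;> simp [hu]
  rw [this, Set.ncard_insert_of_notMem (by simp),
    Set.ncard_image_of_injective _ (Option.some_injective _)]

/-! ### Connectivity -/

theorem conn_sub {V : Type} {H : SimpleGraph V} (hc : H.Connected) {x y : V} (h : H.Adj x y) :
    (subdivide H x y).Connected := by
  have key : ∀ u v, H.Reachable u v → (subdivide H x y).Reachable (some u) (some v) := by
    rintro u v ⟨p⟩
    induction p with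
    | nil => exact Reachable.refl _
    | @cons a b c hab _ ih =>
      refine Reachable.trans ?_ ih
      by_cases e : s(a, b) = s(x, y)
      · have h1 : (subdivide H x y).Adj (some a) none := by
          rw [Sym2.eq_iff] at e; simp; tauto
        have h2 : (subdivide H x y).Adj none (some b) := by
          rw [Sym2.eq_iff] at e; simp; tauto
        exact h1.reachable.trans h2.reachable
      · exact Adj.reachable (by simp only [sub_ss]; exact ⟨hab, e⟩)
  have hx : ∀ p, (subdivide H x y).Reachable p (some x) := by
    intro p
    cases p with
    | none => exact Adj.reachable (by simp)
    | some u => exact key _ _ (hc.preconnected u x)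
  have : Nonempty (Option V) := ⟨none⟩
  exact ⟨fun p q => (hx p).trans (hx q).symm⟩

theorem conn_apex {V : Type} {H : SimpleGraph V} (hc : H.Connected) {S : Set V} {x : V}
    (h : x ∈ S) : (addApex H S).Connected := by
  have key : ∀ u v, H.Reachable u v → (addApex H S).Reachable (some u) (some v) := by
    rintro u v ⟨p⟩
    induction p with
    | nil => exact Reachable.refl _
    | @cons a b c hab _ ih =>
      exact Reachable.trans (Adj.reachable (by simpa using hab)) ih
  have hx : ∀ p, (addApex H S).Reachable p (some x) := by
    intro p
    cases p with
    | none => exact Adj.reachable (by simpa using h)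
    | some u => exact key _ _ (hc.preconnected u x)
  have : Nonempty (Option V) := ⟨none⟩
  exact ⟨fun p q => (hx p).trans (hx q).symm⟩

/-! ### Short cycles and the Moore bound -/

/-- No triangles. -/
def NoC3 {V : Type} (G : SimpleGraph V) : Prop :=
  ∀ a b c, G.Adj a b → G.Adj b c → G.Adj c a → False

/-- No 4-cycles. -/
def NoC4 {V : Type} (G : SimpleGraph V) : Prop :=
  ∀ a b c d, G.Adj a b → G.Adj b c → G.Adj c d → G.Adj d a → a ≠ c → b = d

theorem noC3_of_girth {V : Type} {G : SimpleGraph V} (hg : 5 ≤ G.egirth) : NoC3 G := by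
  intro a b c hab hbc hca
  have hc : (Walk.cons hab (Walk.cons hbc (Walk.cons hca Walk.nil))).IsCycle := by
    simp [Walk.isCycle_def, Walk.isTrail_def, hab.ne, hab.ne.symm, hbc.ne, hbc.ne.symm,
      hca.ne, hca.ne.symm]
  have := le_egirth.1 hg a _ hc
  simp at this
  exact absurd this (by decide)

theorem noC4_of_girth {V : Type} {G : SimpleGraph V} (hg : 5 ≤ G.egirth) : NoC4 G := by
  intro a b c d hab hbc hcd hda hac
  by_contra hbd
  have hc : (Walk.cons hab (Walk.cons hbc (Walk.cons hcd (Walk.cons hda Walk.nil)))).IsCycle := by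
    simp [Walk.isCycle_def, Walk.isTrail_def, hab.ne, hab.ne.symm, hbc.ne, hbc.ne.symm,
      hcd.ne, hcd.ne.symm, hda.ne, hda.ne.symm, hac, Ne.symm hac, hbd, Ne.symm hbd]
  have := le_egirth.1 hg a _ hc
  simp at this
  exact absurd this (by decide)

theorem moore {V : Type} [Finite V] {G : SimpleGraph V} (h3 : NoC3 G) (h4 : NoC4 G) {v : V}
    (hv : (G.neighborSet v).ncard = 3) (k : ℕ)
    (hk : ∀ u, G.Adj v u → k + 1 ≤ (G.neighborSet u).ncard) : 4 + 3 * k ≤ Nat.card V := by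
  classical
  obtain ⟨a, b, c, hab, hac, hbc, hN⟩ := Set.ncard_eq_three.1 hv
  have hva : G.Adj v a := by rw [← mem_neighborSet, hN]; simp
  have hvb : G.Adj v b := by rw [← mem_neighborSet, hN]; simp
  have hvc : G.Adj v c := by rw [← mem_neighborSet, hN]; simp
  have hd : ∀ u, G.Adj v u → k ≤ (G.neighborSet u \ {v}).ncard := by
    intro u hu
    have := hk u hu
    have := Set.ncard_sdiff_singleton_add_one (s := G.neighborSet u) (a := v) hu.symm
    omega
  have disj : ∀ p q, G.Adj v p → G.Adj v q → p ≠ q →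
      Disjoint (G.neighborSet p \ {v}) (G.neighborSet q \ {v}) := by
    intro p q hp hq hpq
    rw [Set.disjoint_left]
    rintro z ⟨hz1, hz2⟩ ⟨hz3, _⟩
    exact hpq (h4 v p z q hp hz1 (SimpleGraph.Adj.symm hz3) hq.symm (fun e => hz2 e.symm))
  have e1 := Set.ncard_union_eq (disj a b hva hvb hab)
  have e2 : ((G.neighborSet a \ {v} ∪ G.neighborSet b \ {v}) ∪ G.neighborSet c \ {v}).ncard
      = _ := Set.ncard_union_eq (by
    rw [Set.disjoint_union_left]
    exact ⟨disj a c hva hvc hac, disj b c hvb hvc hbc⟩)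
  have e3 : (insert v (G.neighborSet v)).ncard = 4 := by
    rw [Set.ncard_insert_of_notMem (by simp), hv]
  have e4 : (insert v (G.neighborSet v) ∪
      ((G.neighborSet a \ {v} ∪ G.neighborSet b \ {v}) ∪ G.neighborSet c \ {v})).ncard = _ :=
    Set.ncard_union_eq (by
      have aux : ∀ p, G.Adj v p →
          Disjoint (insert v (G.neighborSet v)) (G.neighborSet p \ {v}) := by
        intro p hp
        rw [Set.disjoint_left]
        rintro z hz ⟨hz1, hz2⟩
        rcases hz with rfl | hz
        · exact hz2 rfl
        · exact h3 v p z hp hz1 (SimpleGraph.Adj.symm hz)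
      rw [Set.disjoint_union_right, Set.disjoint_union_right]
      exact ⟨⟨aux a hva, aux b hvb⟩, aux c hvc⟩)
  have := hd a hva
  have := hd b hvb
  have := hd c hvc
  have := Set.ncard_le_card (insert v (G.neighborSet v) ∪
      ((G.neighborSet a \ {v} ∪ G.neighborSet b \ {v}) ∪ G.neighborSet c \ {v}))
  omega

/-! ### The forward direction -/

theorem memF_le {i j : ℕ} {V : Type} {G : SimpleGraph V} (h : MemF i j G) : j ≤ i := by
  induction h <;> omega

theorem cubic_apex {U : Type} [Finite U] {K : SimpleGraph (Option (Option U))} (a : U)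
    (h1 : (K.neighborSet (some (some a))).ncard = 2) (h2 : (K.neighborSet (some none)).ncard = 2)
    (h3 : (K.neighborSet none).ncard = 2)
    (h4 : ∀ u, u ≠ a → (K.neighborSet (some (some u))).ncard = 3) :
    Cubic (addApex K {some (some a), some none, none}) := by
  intro p
  rcases p with _ | _ | _ | u
  · rw [deg_apex_none, Set.ncard_eq_three]
    exact ⟨_, _, _, by simp, by simp, by simp, rfl⟩
  · rw [deg_apex_mem _ (by simp), h3]
  · rw [deg_apex_mem _ (by simp), h2]
  · by_cases e : u = a
    · subst e
      rw [deg_apex_mem _ (by simp), h1]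
    · rw [deg_apex_some _ (by simp [e]), h4 u e]

theorem circ_props {U W : Type} [Finite U] {K : SimpleGraph U} {a : U} {e1 e2 : Sym2 U}
    {G : SimpleGraph W} (hc : K.Connected) (ha : (K.neighborSet a).ncard = 2)
    (hu : ∀ u, u ≠ a → (K.neighborSet u).ncard = 3)
    (he1 : e1 ∈ K.edgeSet) (he2 : e2 ∈ K.edgeSet) (h : IsCircOp K e1 e2 a G) :
    G.Connected ∧ Cubic G ∧ Nat.card W = Nat.card U + 3 := by
  have fin : ∀ M : SimpleGraph (Option (Option (Option U))), Nonempty (G ≃g M) → M.Connected →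
      Cubic M → G.Connected ∧ Cubic G ∧ Nat.card W = Nat.card U + 3 := by
    rintro M ⟨f⟩ h1 h2
    refine ⟨f.connected_iff.2 h1, fun v => ?_, ?_⟩
    · rw [← deg_iso f, h2]
    · rw [Nat.card_congr f.toEquiv]
      simp [Finite.card_option]
  rcases h with ⟨hne, x1, y1, x2, y2, rfl, rfl, hf⟩ | ⟨rfl, x, y, rfl, hf⟩
  · rw [mem_edgeSet] at he1 he2
    have hA : (subdivide K x1 y1).Adj (some x2) (some y2) := by
      rw [sub_ss]; exact ⟨he2, fun e => hne e.symm⟩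
    refine fin _ hf (conn_apex (x := none) (conn_sub (conn_sub hc he1) hA) (by simp)) ?_
    apply cubic_apex
    · rw [deg_sub_some _ hA, deg_sub_some _ he1, ha]
    · rw [deg_sub_some _ hA, deg_sub_none _ he1]
    · rw [deg_sub_none _ hA]
    · intro u h
      rw [deg_sub_some _ hA, deg_sub_some _ he1, hu u h]
  · rw [mem_edgeSet] at he1
    have hA : (subdivide K x y).Adj none (some y) := by simp
    refine fin _ hf (conn_apex (x := none) (conn_sub (conn_sub hc he1) hA) (by simp)) ?_
    apply cubic_apex
    · rw [deg_sub_some _ hA, deg_sub_some _ he1, ha]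
    · rw [deg_sub_some _ hA, deg_sub_none _ he1]
    · rw [deg_sub_none _ hA]
    · intro u h
      rw [deg_sub_some _ hA, deg_sub_some _ he1, hu u h]

theorem memF_diag {i j : ℕ} {V : Type} {G : SimpleGraph V} (h : MemF i j G) (hij : i = j)
    (hj : 1 ≤ j) : G.Connected ∧ Cubic G ∧ Nat.card V = 4 * j := by
  induction h with
  | cycle hi h => omega
  | k4 h =>
    obtain ⟨f⟩ := h
    refine ⟨f.connected_iff.2 connected_top, fun v => ?_, ?_⟩
    · rw [← deg_iso f]
      simp [Set.ncard_eq_toFinset_card', Finset.card_compl]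
    · rw [Nat.card_congr f.toEquiv]; simp
  | @circ j hj V H hH x y hxy e1 e2 he1 he2 W G hG ih =>
    obtain ⟨h1, h2, h3⟩ := ih rfl (by omega)
    have : Finite V := Nat.finite_of_card_ne_zero (by omega)
    have := circ_props (conn_sub h1 hxy) (deg_sub_none _ hxy) (by
      intro u hu
      cases u with
      | none => exact absurd rfl hu
      | some u => rw [deg_sub_some _ hxy, h2]) he1 he2 hG
    refine ⟨this.1, this.2.1, ?_⟩
    rw [this.2.2, Finite.card_option, h3]
    omega
  | subd hj hH =>
    have := memF_le hH
    omega

theorem forward_two {V W : Type} {H : SimpleGraph V} {G : SimpleGraph W} (hH : Cubic H)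
    (hV : Nat.card V = 8) {x y : V} (hxy : H.Adj x y) (f : G ≃g subdivide H x y)
    (h3 : NoC3 G) (h4 : NoC4 G) : False := by
  have : Finite V := Nat.finite_of_card_ne_zero (by omega)
  have : Finite W := Finite.of_equiv _ f.toEquiv.symm
  obtain ⟨u, hu⟩ : ∃ u, u ∉ ({x, y} : Set V) := by
    by_contra! hcon
    have h1 : ({x, y} : Set V) = Set.univ := Set.eq_univ_of_forall hcon
    have h2 := Set.ncard_pair hxy.ne
    rw [h1, Set.ncard_univ] at h2
    omega
  have hux : u ≠ x ∧ u ≠ y := by simpa using hu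
  have := moore h3 h4 (v := f.symm (some u)) (by
    rw [deg_iso f.symm, deg_sub_some _ hxy, hH]) 2 (by
    intro z hz
    have hz' : (subdivide H x y).Adj (some u) (f z) := by
      simpa using f.map_adj_iff.2 hz
    rw [← deg_iso f]
    cases hfz : f z with
    | none => rw [hfz] at hz'; simp [hux] at hz'
    | some t => rw [deg_sub_some _ hxy, hH])
  rw [Nat.card_congr f.toEquiv, Finite.card_option] at this
  omega

theorem forward_one {V W Z : Type} {H : SimpleGraph V} {G : SimpleGraph W} {K : SimpleGraph Z}
    (hH : Cubic H)
    (hV : Nat.card V = 4) {x y : V} (hxy : H.Adj x y) (f : G ≃g subdivide H x y)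
    {p q : W} (hpq : G.Adj p q) (g : K ≃g subdivide G p q)
    (h3 : NoC3 K) (h4 : NoC4 K) : False := by
  have : Finite V := Nat.finite_of_card_ne_zero (by omega)
  have : Finite W := Finite.of_equiv _ f.toEquiv.symm
  have : Finite Z := Finite.of_equiv _ g.toEquiv.symm
  have hG : ∀ w, 2 ≤ (G.neighborSet w).ncard := by
    intro w
    rw [← deg_iso f]
    cases f w with
    | none => rw [deg_sub_none _ hxy]
    | some t => rw [deg_sub_some _ hxy, hH]; omega
  have := moore h3 h4 (v := g.symm (some (f.symm (some x)))) (by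
    rw [deg_iso g.symm, deg_sub_some _ hpq, deg_iso f.symm, deg_sub_some _ hxy, hH]) 1 (by
    intro z _
    rw [← deg_iso g]
    cases g z with
    | none => rw [deg_sub_none _ hpq]
    | some t => rw [deg_sub_some _ hpq]; exact hG t)
  rw [Nat.card_congr g.toEquiv, Finite.card_option, Nat.card_congr f.toEquiv,
    Finite.card_option] at this
  omega

theorem forward {V : Type} (G : SimpleGraph V) (j : ℕ) (hF : MemF 3 j G)
    (hg : 5 ≤ G.egirth) : j = 3 ∧ G.Connected ∧ Cubic G ∧ Nat.card V = 12 := by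
  have h3 := noC3_of_girth hg
  have h4 := noC4_of_girth hg
  by_cases hj : j = 3
  · subst hj
    exact ⟨rfl, by simpa using memF_diag hF rfl (by omega)⟩
  exfalso
  cases hF with
  | cycle hi h =>
    obtain ⟨f⟩ := h
    have aux : ∀ a b : ZMod 3, b = a + 1 → a ≠ b → G.Adj (f.symm a) (f.symm b) := by
      intro a b hab hne
      rw [f.symm.map_adj_iff]
      simp [cyc, SimpleGraph.fromRel_adj, hab]
    exact h3 _ _ _ (aux 0 1 (by decide) (by decide)) (aux 1 2 (by decide) (by decide))
      (aux 2 0 (by decide) (by decide))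
  | circ hj2 => exact hj rfl
  | @subd _ _ hj1 V' H hH x y hxy _ _ hG =>
    obtain ⟨f⟩ := hG
    have hle := memF_le hH
    have : j = 1 ∨ j = 2 := by omega
    rcases this with rfl | rfl
    · cases hH with
      | @subd _ _ hj1 V'' H' hH' x' y' hxy' _ _ hG' =>
        obtain ⟨f'⟩ := hG'
        obtain ⟨_, hcub, hcard⟩ := memF_diag hH' rfl le_rfl
        exact forward_one hcub (by omega) hxy' f' hxy f h3 h4
    · obtain ⟨_, hcub, hcard⟩ := memF_diag hH rfl (by omega)
      exact forward_two hcub (by omega) hxy f h3 h4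

/-! ### The converse direction -/

theorem other_nbrs {V : Type} {G : SimpleGraph V} (hG : Cubic G) {a w : V} (h : G.Adj a w) :
    ∃ a1 a2, a1 ≠ a2 ∧ a1 ≠ w ∧ a2 ≠ w ∧ ∀ z, G.Adj a z ↔ z = w ∨ z = a1 ∨ z = a2 := by
  obtain ⟨p, q, r, hpq, hpr, hqr, hN⟩ := Set.ncard_eq_three.1 (hG a)
  have hz : ∀ z, G.Adj a z ↔ z = p ∨ z = q ∨ z = r := by
    intro z
    rw [← mem_neighborSet, hN]
    simp
  rcases (hz w).1 h with rfl | rfl | rfl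
  · exact ⟨q, r, hqr, hpq.symm, hpr.symm, hz⟩
  · exact ⟨p, r, hpr, hpq, hqr.symm, fun z => by rw [hz]; tauto⟩
  · exact ⟨p, q, hpq, hpr, hqr, fun z => by rw [hz]; tauto⟩

theorem pair_ne {V : Type} {G : SimpleGraph V}
    {w a b a1 a2 b1 b2 : V} (hN : G.neighborSet a ≠ G.neighborSet b)
    (Aa : ∀ z, G.Adj a z ↔ z = w ∨ z = a1 ∨ z = a2)
    (Ab : ∀ z, G.Adj b z ↔ z = w ∨ z = b1 ∨ z = b2) : s(a1, a2) ≠ s(b1, b2) := by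
  intro e
  apply hN
  ext z
  rw [mem_neighborSet, mem_neighborSet, Aa, Ab]
  rw [Sym2.eq_iff] at e
  rcases e with ⟨rfl, rfl⟩ | ⟨rfl, rfl⟩ <;> tauto

/-- The graph left after deleting `w` and suppressing its three neighbours. -/
def reduced {V : Type} (G : SimpleGraph V) (S : Set V) (e1 e2 e3 : Sym2 V) : SimpleGraph S :=
  SimpleGraph.fromRel (fun u v => G.Adj u v ∨ s(u.1, v.1) = e1 ∨ s(u.1, v.1) = e2 ∨
    s(u.1, v.1) = e3)

theorem reduced_adj {V : Type} (G : SimpleGraph V) (S : Set V) (e1 e2 e3 : Sym2 V) (u v : S) :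
    (reduced G S e1 e2 e3).Adj u v ↔ u.1 ≠ v.1 ∧ (G.Adj u v ∨ s(u.1, v.1) = e1 ∨
      s(u.1, v.1) = e2 ∨ s(u.1, v.1) = e3) := by
  simp only [reduced, SimpleGraph.fromRel_adj, Sym2.eq_swap (a := v.1), G.adj_comm v.1]
  rw [or_self, Ne, Ne, Subtype.ext_iff]

theorem sym2_coe {V : Type} {S : Set V} (a b c d : S) :
    s(a, b) = s(c, d) ↔ s(a.1, b.1) = s(c.1, d.1) := by
  simp [Sym2.eq_iff, Subtype.ext_iff]

theorem sym2_some {V : Type} (a b c d : V) :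
    s(some a, some b) = s(some c, some d) ↔ s(a, b) = s(c, d) := by
  simp [Sym2.eq_iff]

set_option maxHeartbeats 1000000 in
theorem reduce {V : Type} [Finite V] {G : SimpleGraph V} (hG : Cubic G) (h3 : NoC3 G) (w : V)
    (hN : ∀ p q, G.Adj w p → G.Adj w q → p ≠ q → G.neighborSet p ≠ G.neighborSet q) :
    ∃ (S : Set V) (H : SimpleGraph S), Cubic H ∧ Nat.card S + 4 = Nat.card V ∧
      (NoC4 G → NoC3 H) ∧ ∃ (x y : S) (_ : H.Adj x y) (e1 e2 : Sym2 (Option S))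
        (_ : e1 ∈ (subdivide H x y).edgeSet) (_ : e2 ∈ (subdivide H x y).edgeSet),
        IsCircOp (subdivide H x y) e1 e2 none G := by
  classical
  obtain ⟨a, b, c, hab, hac, hbc, hNw⟩ := Set.ncard_eq_three.1 (hG w)
  have Aw : ∀ z, G.Adj w z ↔ z = a ∨ z = b ∨ z = c := by
    intro z
    rw [← mem_neighborSet, hNw]
    simp
  have hwa : G.Adj w a := by simp [Aw]
  have hwb : G.Adj w b := by simp [Aw]
  have hwc : G.Adj w c := by simp [Aw]
  obtain ⟨a1, a2, ha, haw1, haw2, Aa⟩ := other_nbrs hG hwa.symm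
  obtain ⟨b1, b2, hb, hbw1, hbw2, Ab⟩ := other_nbrs hG hwb.symm
  obtain ⟨c1, c2, hc, hcw1, hcw2, Ac⟩ := other_nbrs hG hwc.symm
  have nab : s(a1, a2) ≠ s(b1, b2) := pair_ne (hN a b hwa hwb hab) Aa Ab
  have nac : s(a1, a2) ≠ s(c1, c2) := pair_ne (hN a c hwa hwc hac) Aa Ac
  have nbc : s(b1, b2) ≠ s(c1, c2) := pair_ne (hN b c hwb hwc hbc) Ab Ac
  have xab : ¬ G.Adj a b := fun h => h3 w a b hwa h hwb.symm
  have xac : ¬ G.Adj a c := fun h => h3 w a c hwa h hwc.symm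
  have xbc : ¬ G.Adj b c := fun h => h3 w b c hwb h hwc.symm
  let S : Set V := {w, a, b, c}ᶜ
  have memS : ∀ z, z ∈ S ↔ z ≠ w ∧ z ≠ a ∧ z ≠ b ∧ z ≠ c := by
    intro z
    simp [S]
  have inS : ∀ p z, G.Adj w p → G.Adj p z → z ≠ w → z ∈ S := by
    intro p z hp hz hzw
    rw [memS]
    refine ⟨hzw, ?_, ?_, ?_⟩ <;> rintro rfl
    · exact h3 w p _ hp hz hwa.symm
    · exact h3 w p _ hp hz hwb.symm
    · exact h3 w p _ hp hz hwc.symm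
  have Sa1 : a1 ∈ S := inS a _ hwa ((Aa _).2 (by simp)) haw1
  have Sa2 : a2 ∈ S := inS a _ hwa ((Aa _).2 (by simp)) haw2
  have Sb1 : b1 ∈ S := inS b _ hwb ((Ab _).2 (by simp)) hbw1
  have Sb2 : b2 ∈ S := inS b _ hwb ((Ab _).2 (by simp)) hbw2
  have Sc1 : c1 ∈ S := inS c _ hwc ((Ac _).2 (by simp)) hcw1
  have Sc2 : c2 ∈ S := inS c _ hwc ((Ac _).2 (by simp)) hcw2
  let H : SimpleGraph S := reduced G S s(c1, c2) s(a1, a2) s(b1, b2)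
  have HA : ∀ u v : S, H.Adj u v ↔ u.1 ≠ v.1 ∧ (G.Adj u v ∨ s(u.1, v.1) = s(c1, c2) ∨
      s(u.1, v.1) = s(a1, a2) ∨ s(u.1, v.1) = s(b1, b2)) := reduced_adj _ _ _ _ _
  have Hc : H.Adj ⟨c1, Sc1⟩ ⟨c2, Sc2⟩ := by rw [HA]; exact ⟨hc, by simp⟩
  have Ha : H.Adj ⟨a1, Sa1⟩ ⟨a2, Sa2⟩ := by rw [HA]; exact ⟨ha, by simp⟩
  have Hb : H.Adj ⟨b1, Sb1⟩ ⟨b2, Sb2⟩ := by rw [HA]; exact ⟨hb, by simp⟩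
  let K1 := subdivide H ⟨c1, Sc1⟩ ⟨c2, Sc2⟩
  have Ka : K1.Adj (some ⟨a1, Sa1⟩) (some ⟨a2, Sa2⟩) := by
    rw [sub_ss, Ne, sym2_coe]; exact ⟨Ha, nac⟩
  have Kb : K1.Adj (some ⟨b1, Sb1⟩) (some ⟨b2, Sb2⟩) := by
    rw [sub_ss, Ne, sym2_coe]; exact ⟨Hb, nbc⟩
  let K2 := subdivide K1 (some ⟨a1, Sa1⟩) (some ⟨a2, Sa2⟩)
  have Kb2 : K2.Adj (some (some ⟨b1, Sb1⟩)) (some (some ⟨b2, Sb2⟩)) := by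
    rw [sub_ss, Ne, sym2_some, sym2_coe]; exact ⟨Kb, nab.symm⟩
  let K3 := subdivide K2 (some (some ⟨b1, Sb1⟩)) (some (some ⟨b2, Sb2⟩))
  let K4 := addApex K3 {some (some none), some none, none}
  let F : Option (Option (Option (Option S))) → V := fun p =>
    match p with
    | none => w
    | some none => b
    | some (some none) => a
    | some (some (some none)) => c
    | some (some (some (some s))) => s.1
  have Finj : Function.Injective F := by
    have hS : ∀ s : S, s.1 ≠ w ∧ s.1 ≠ a ∧ s.1 ≠ b ∧ s.1 ≠ c := fun s => (memS s.1).1 s.2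
    rintro (_ | _ | _ | _ | s) (_ | _ | _ | _ | t) <;>
      simp only [F, Option.some.injEq, reduceCtorEq, imp_false, implies_true, imp_self] <;>
      first
        | exact fun e => Subtype.ext e
        | (intro e; first
            | exact (hS s).1 e | exact (hS s).2.1 e | exact (hS s).2.2.1 e | exact (hS s).2.2.2 e
            | exact (hS t).1 e.symm | exact (hS t).2.1 e.symm | exact (hS t).2.2.1 e.symm
            | exact (hS t).2.2.2 e.symm
            | exact hab e | exact hac e | exact hbc e | exact hab e.symm | exact hac e.symm
            | exact hbc e.symm | exact hwa.ne e | exact hwb.ne e | exact hwc.ne e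
            | exact hwa.ne e.symm | exact hwb.ne e.symm | exact hwc.ne e.symm)
  have Fsurj : Function.Surjective F := by
    intro z
    by_cases hz : z ∈ S
    · exact ⟨some (some (some (some ⟨z, hz⟩))), rfl⟩
    · have : z = w ∨ z = a ∨ z = b ∨ z = c := by
        by_contra hcon
        exact hz ((memS z).2 (by tauto))
      rcases this with rfl | rfl | rfl | rfl
      · exact ⟨none, rfl⟩
      · exact ⟨some (some none), rfl⟩
      · exact ⟨some none, rfl⟩
      · exact ⟨some (some (some none)), rfl⟩
  have adjS : ∀ (p p1 p2 : V), (∀ z, G.Adj p z ↔ z = w ∨ z = p1 ∨ z = p2) → ∀ s : S,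
      (G.Adj p s ↔ s.1 = p1 ∨ s.1 = p2) := by
    intro p p1 p2 hp s
    rw [hp]
    have := ((memS s.1).1 s.2).1
    tauto
  have nadj : ∀ (p p1 p2 : V), G.Adj p p1 → G.Adj p p2 → ∀ u v, G.Adj u v →
      s(u, v) ≠ s(p1, p2) := by
    intro p p1 p2 hp1 hp2 u v huv e
    rw [Sym2.eq_iff] at e
    rcases e with ⟨rfl, rfl⟩ | ⟨rfl, rfl⟩
    · exact h3 p _ _ hp1 huv hp2.symm
    · exact h3 p _ _ hp2 huv hp1.symm
  have na := nadj a a1 a2 ((Aa _).2 (by simp)) ((Aa _).2 (by simp))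
  have nb := nadj b b1 b2 ((Ab _).2 (by simp)) ((Ab _).2 (by simp))
  have nc := nadj c c1 c2 ((Ac _).2 (by simp)) ((Ac _).2 (by simp))
  have Fadj0 : ∀ s t : S, G.Adj s t ↔
      K4.Adj (some (some (some (some s)))) (some (some (some (some t)))) := by
    intro s t
    simp only [K4, K3, K2, K1, apex_ss, sub_ss, HA, Ne, sym2_some, sym2_coe]
    constructor
    · intro h
      exact ⟨⟨⟨⟨h.ne, Or.inl h⟩, nc _ _ h⟩, na _ _ h⟩, nb _ _ h⟩
    · tauto
  have Fw : ∀ p, G.Adj (F none) (F p) ↔ K4.Adj none p := by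
    have hS : ∀ s : S, s.1 ≠ w ∧ s.1 ≠ a ∧ s.1 ≠ b ∧ s.1 ≠ c := fun s => (memS s.1).1 s.2
    rintro (_ | _ | _ | _ | s)
    · simp [F]
    · simp [F, K4, hwb]
    · simp [F, K4, hwa]
    · simp [F, K4, hwc]
    · simp [F, K4, Aw, hS s]
  have Fb : ∀ p, G.Adj (F (some none)) (F p) ↔ K4.Adj (some none) p := by
    rintro (_ | _ | _ | _ | s)
    · simp [F, K4, hwb.symm]
    · simp [F]
    · simp [F, K4, K3, G.adj_comm b a, xab]
    · simp [F, K4, K3, xbc]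
    · simp [F, K4, K3, adjS b b1 b2 Ab, Subtype.ext_iff]
  have Fa : ∀ p, G.Adj (F (some (some none))) (F p) ↔ K4.Adj (some (some none)) p := by
    rintro (_ | _ | _ | _ | s)
    · simp [F, K4, hwa.symm]
    · simp [F, K4, K3, xab]
    · simp [F]
    · simp [F, K4, K3, K2, xac]
    · simp [F, K4, K3, K2, adjS a a1 a2 Aa, Subtype.ext_iff]
  have Fc : ∀ p, G.Adj (F (some (some (some none)))) (F p) ↔
      K4.Adj (some (some (some none))) p := by
    rintro (_ | _ | _ | _ | s)
    · simp [F, K4, hwc.symm]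
    · simp [F, K4, K3, G.adj_comm c b, xbc]
    · simp [F, K4, K3, K2, G.adj_comm c a, xac]
    · simp [F]
    · simp [F, K4, K3, K2, K1, adjS c c1 c2 Ac, Subtype.ext_iff]
  have Fadj : ∀ p q, G.Adj (F p) (F q) ↔ K4.Adj p q := by
    intro p q
    rcases p with _ | _ | _ | _ | s
    · exact Fw q
    · exact Fb q
    · exact Fa q
    · exact Fc q
    rcases q with _ | _ | _ | _ | t
    · rw [G.adj_comm, K4.adj_comm]; exact Fw (some (some (some (some s))))
    · rw [G.adj_comm, K4.adj_comm]; exact Fb (some (some (some (some s))))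
    · rw [G.adj_comm, K4.adj_comm]; exact Fa (some (some (some (some s))))
    · rw [G.adj_comm, K4.adj_comm]; exact Fc (some (some (some (some s))))
    · exact Fadj0 s t
  let f : K4 ≃g G := ⟨Equiv.ofBijective F ⟨Finj, Fsurj⟩, fun {p q} => Fadj p q⟩
  refine ⟨S, H, ?_, ?_, ?_, ⟨c1, Sc1⟩, ⟨c2, Sc2⟩, Hc, s(some ⟨a1, Sa1⟩, some ⟨a2, Sa2⟩),
    s(some ⟨b1, Sb1⟩, some ⟨b2, Sb2⟩), Ka, Kb, Or.inl ⟨?_, _, _, _, _, rfl, rfl, ⟨f.symm⟩⟩⟩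
  · intro s
    have h := deg_iso f (some (some (some (some s))))
    rw [hG, deg_apex_some _ (by simp), deg_sub_some _ Kb2, deg_sub_some _ Ka,
      deg_sub_some _ Hc] at h
    exact h.symm
  · rw [← Nat.card_congr f.toEquiv]
    simp [Finite.card_option]
  · intro h4 p q r hpq hqr hrp
    -- each edge of the reduced graph is an edge of `G` or a 2-path through a neighbour of `w`
    have cl : ∀ u v : S, H.Adj u v → G.Adj u v ∨ ∃ m, G.Adj w m ∧ m ∉ S ∧ G.Adj m u ∧ G.Adj m v ∧
        u.1 ≠ v.1 := by
      intro u v huv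
      obtain ⟨hne, h | h | h | h⟩ := (HA u v).1 huv
      · exact Or.inl h
      · refine Or.inr ⟨c, hwc, by simp [memS], ?_, ?_, hne⟩ <;> rw [Ac] <;>
          rw [Sym2.eq_iff] at h <;> tauto
      · refine Or.inr ⟨a, hwa, by simp [memS], ?_, ?_, hne⟩ <;> rw [Aa] <;>
          rw [Sym2.eq_iff] at h <;> tauto
      · refine Or.inr ⟨b, hwb, by simp [memS], ?_, ?_, hne⟩ <;> rw [Ab] <;>
          rw [Sym2.eq_iff] at h <;> tauto
    have two : ∀ p q r : S, H.Adj p q → H.Adj q r → H.Adj r p → ∀ m n, G.Adj w m → G.Adj w n →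
        G.Adj m p → G.Adj m q → G.Adj n q → G.Adj n r → False := by
      intro p q r hpq hqr hrp m n hm hn h1 h2 h3' h4'
      have hmn : m = n := h4 w m q n hm h2 h3'.symm hn.symm (((memS q.1).1 q.2).1).symm
      subst hmn
      obtain ⟨m1, m2, _, _, _, Am⟩ := other_nbrs hG hm.symm
      have e1 := (adjS m m1 m2 Am p).1 h1
      have e2 := (adjS m m1 m2 Am q).1 h2
      have e3 := (adjS m m1 m2 Am r).1 h4'
      have n1 : p.1 ≠ q.1 := fun e => hpq.ne (Subtype.ext e)
      have n2 : q.1 ≠ r.1 := fun e => hqr.ne (Subtype.ext e)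
      have n3 : r.1 ≠ p.1 := fun e => hrp.ne (Subtype.ext e)
      rcases e1 with e1 | e1 <;> rcases e2 with e2 | e2 <;> rcases e3 with e3 | e3 <;>
        first
          | exact n1 (e1.trans e2.symm)
          | exact n2 (e2.trans e3.symm)
          | exact n3 (e3.trans e1.symm)
    have one : ∀ p q r : S, G.Adj q r → G.Adj r p → ∀ m, m ∉ S → G.Adj m p → G.Adj m q →
        p.1 ≠ q.1 → False := by
      intro p q r hqr hrp m hm h1 h2 hne
      have := h4 p m q r h1.symm h2 hqr hrp hne
      exact hm (this ▸ r.2)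
    rcases cl p q hpq with h1 | ⟨m, hm, hmS, hmp, hmq, n1⟩ <;>
      rcases cl q r hqr with h2 | ⟨n, hn, hnS, hnq, hnr, n2⟩ <;>
      rcases cl r p hrp with h5 | ⟨k, hk, hkS, hkr, hkp, n3⟩
    · exact h3 _ _ _ h1 h2 h5
    · exact one r p q h1 h2 k hkS hkr hkp n3
    · exact one q r p h5 h1 n hnS hnq hnr n2
    · exact two q r p hqr hrp hpq n k hn hk hnq hnr hkr hkp
    · exact one p q r h2 h5 m hmS hmp hmq n1
    · exact two r p q hrp hpq hqr k m hk hm hkr hkp hmp hmq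
    · exact two p q r hpq hqr hrp m n hm hn hmp hmq hnq hnr
    · exact two p q r hpq hqr hrp m n hm hn hmp hmq hnq hnr
  · rw [Ne, sym2_some, sym2_coe]; exact nab

theorem nbhd_ne {V : Type} [Finite V] {G : SimpleGraph V} (hG : Cubic G) (h3 : NoC3 G)
    (hV : Nat.card V = 8) {w a b : V} (ha : G.Adj w a) (hb : G.Adj w b) (hab : a ≠ b) :
    G.neighborSet a ≠ G.neighborSet b := by
  classical
  intro hN
  have hs : (insert a (insert b (G.neighborSet a))).ncard = 5 := by
    rw [Set.ncard_insert_of_notMem, Set.ncard_insert_of_notMem, hG]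
    · rw [hN]; simp
    · simp [hab]
  have hT : ((insert a (insert b (G.neighborSet a)))ᶜ).ncard = 3 := by
    have := Set.ncard_add_ncard_compl (insert a (insert b (G.neighborSet a)))
    omega
  obtain ⟨p, q, r, hpq, hpr, hqr, hT⟩ := Set.ncard_eq_three.1 hT
  have hz : ∀ z, z ≠ a → z ≠ b → ¬ G.Adj a z → z = p ∨ z = q ∨ z = r := by
    intro z h1 h2 h3
    have : z ∈ (insert a (insert b (G.neighborSet a)))ᶜ := by simp [h1, h2, h3]
    rw [hT] at this
    simpa using this
  have hT' : ∀ z, z = p ∨ z = q ∨ z = r → z ≠ a ∧ z ≠ b ∧ ¬ G.Adj a z := by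
    intro z h
    have : z ∈ (insert a (insert b (G.neighborSet a)))ᶜ := by rw [hT]; simpa using h
    simpa using this
  have key : ∀ p q r, p ≠ q → p ≠ r → q ≠ r → (∀ z, z ≠ a → z ≠ b → ¬ G.Adj a z → z = p ∨ z = q ∨ z = r) →
      (∀ z, z = p ∨ z = q ∨ z = r → z ≠ a ∧ z ≠ b ∧ ¬ G.Adj a z) → G.Adj p q := by
    intro p q r hpq hpr hqr hz hT'
    by_contra hn
    have hp := hT' p (by simp)
    have hq := hT' q (by simp)
    have hbb : ∀ z, G.Adj b z ↔ G.Adj a z := fun z => by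
      rw [← mem_neighborSet, ← hN, mem_neighborSet]
    have sub : ∀ u, u = p ∨ u = q → G.neighborSet u ⊆ insert r (G.neighborSet a) := by
      intro u hu z hzu
      rw [mem_neighborSet] at hzu
      by_contra hcon
      simp only [Set.mem_insert_iff, mem_neighborSet, not_or] at hcon
      have hu' := hT' u (by tauto)
      have hza : z ≠ a := by rintro rfl; exact hu'.2.2 hzu.symm
      have hzb : z ≠ b := by rintro rfl; exact hu'.2.2 ((hbb _).1 hzu.symm)
      rcases hz z hza hzb hcon.2 with rfl | rfl | rfl
      · rcases hu with rfl | rfl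
        · exact hzu.ne rfl
        · exact hn hzu.symm
      · rcases hu with rfl | rfl
        · exact hn hzu
        · exact hzu.ne rfl
      · exact hcon.1 rfl
    have c1 := Set.ncard_union_add_ncard_inter (G.neighborSet p) (G.neighborSet q)
    have c2 := Set.ncard_le_ncard (Set.union_subset (sub p (by simp)) (sub q (by simp)))
    have c3 := Set.ncard_insert_le r (G.neighborSet a)
    rw [hG, hG] at c1
    rw [hG] at c3
    obtain ⟨z, hzm, hzr⟩ := Set.exists_ne_of_one_lt_ncard
      (s := G.neighborSet p ∩ G.neighborSet q) (by omega) r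
    have hza : G.Adj a z := by
      have := sub p (by simp) hzm.1
      simpa [hzr] using this
    have hle : ({a, b, p, q} : Set V) ⊆ G.neighborSet z := by
      intro t ht
      simp only [Set.mem_insert_iff, Set.mem_singleton_iff] at ht
      rcases ht with rfl | rfl | rfl | rfl
      · exact hza.symm
      · exact ((hbb _).2 hza).symm
      · exact SimpleGraph.Adj.symm hzm.1
      · exact SimpleGraph.Adj.symm hzm.2
    have := Set.ncard_le_ncard hle
    rw [hG, Set.ncard_insert_of_notMem (by simp [hab, hp.1.symm, hq.1.symm]),
      Set.ncard_insert_of_notMem (by simp [hp.2.1.symm, hq.2.1.symm]), Set.ncard_pair hpq] at this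
    omega
  have k1 := key p q r hpq hpr hqr hz hT'
  have k2 := key q r p hqr hpq.symm hpr.symm (fun z h1 h2 h3 => by have := hz z h1 h2 h3; tauto)
    (fun z h => hT' z (by tauto))
  have k3 := key r p q hpr.symm hqr.symm hpq (fun z h1 h2 h3 => by have := hz z h1 h2 h3; tauto)
    (fun z h => hT' z (by tauto))
  exact h3 _ _ _ k1 k2 k3

theorem k4_of_card {V : Type} [Finite V] {G : SimpleGraph V} (hG : Cubic G)
    (hV : Nat.card V = 4) : Nonempty (G ≃g (⊤ : SimpleGraph (Fin 4))) := by
  have hadj : ∀ u v, u ≠ v → G.Adj u v := by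
    intro u v huv
    by_contra hn
    have h1 : (insert u (insert v (G.neighborSet u))).ncard = 5 := by
      rw [Set.ncard_insert_of_notMem (by simp [huv]), Set.ncard_insert_of_notMem (by simpa using hn),
        hG]
    have := Set.ncard_le_card (insert u (insert v (G.neighborSet u)))
    omega
  exact ⟨⟨Finite.equivFinOfCardEq hV, fun {u v} => by
    simp only [top_adj, ne_eq, EmbeddingLike.apply_eq_iff_eq]
    exact ⟨hadj u v, fun h => h.ne⟩⟩⟩

theorem backward {V : Type} (G : SimpleGraph V) (hG : Cubic G) (hV : Nat.card V = 12)
    (hg : 5 ≤ G.egirth) : MemF 3 3 G := by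
  have h3 := noC3_of_girth hg
  have h4 := noC4_of_girth hg
  have : Finite V := Nat.finite_of_card_ne_zero (by omega)
  have : Nonempty V := (Nat.card_pos_iff.1 (by omega)).1
  obtain ⟨w⟩ := this
  obtain ⟨S, H, hH, hS, hH3, x, y, hxy, e1, e2, he1, he2, hop⟩ := reduce hG h3 w (by
    intro p q hp hq hpq e
    have hcard := hG p
    obtain ⟨z, hz, hzw⟩ := Set.exists_ne_of_one_lt_ncard (s := G.neighborSet p) (by omega) w
    have hzq : G.Adj q z := by rw [← mem_neighborSet, ← e]; exact hz
    exact hpq (h4 w p z q hp hz hzq.symm hq.symm hzw.symm))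
  replace hH3 := hH3 h4
  have hS8 : Nat.card S = 8 := by omega
  have : Nonempty S := (Nat.card_pos_iff.1 (by omega)).1
  obtain ⟨w'⟩ := this
  obtain ⟨S', H', hH', hS', -, x', y', hxy', e1', e2', he1', he2', hop'⟩ := reduce hH hH3 w'
    (fun p q hp hq hpq => nbhd_ne hH hH3 hS8 hp hq hpq)
  have m1 : MemF 1 1 H' := MemF.k4 (k4_of_card hH' (by omega))
  have m2 : MemF 2 2 H := MemF.circ le_rfl m1 hxy' he1' he2' hop'
  exact MemF.circ (by omega) m2 hxy he1 he2 hop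

/-- members of `F_{3,j}` with girth at least 5 have `j = 3` and are
connected cubic graphs on 12 vertices (i.e. are isomorphic to `R_1` or `R_2`);
conversely, every connected cubic graph on 12 vertices with girth at least 5 belongs
to `F_{3,3}`. -/
theorem statement10 :
    (∀ {V : Type} (G : SimpleGraph V) (j : ℕ), j ≤ 3 → MemF 3 j G → 5 ≤ G.egirth →
      j = 3 ∧ G.Connected ∧ Cubic G ∧ Nat.card V = 12) ∧
    (∀ {V : Type} (G : SimpleGraph V), G.Connected → Cubic G → Nat.card V = 12 →
      5 ≤ G.egirth → MemF 3 3 G) := by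
  exact ⟨fun G j _ hF hg => forward G j hF hg, fun G _ hG hV hg => backward G hG hV hg⟩

end InducedForest
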